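/- The three functions ψ_{00}, ψ_{01}, ψ_{10} on the upper half plane are algebraically independent over ℚ: for every nonzero polynomial P in three variables with rational coefficients, there exists τ ∈ ℍ such that P(ψ_{00}(τ), ψ_{01}(τ), ψ_{10}(τ)) ≠ 0. -/

import Mathlib

open Complex BigOperators

noncomputable section

/-- The genus-one thetanull `θ₀₀(τ) = ∑ₙ exp(πi n² τ)`. -/
def theta00 (τ : ℂ) : ℂ :=
  ∑' n : ℤ, Complex.exp ((Real.pi : ℂ) * Complex.I * (n : ℂ) ^ 2 * τ)

/-- The genus-one thetanull `θ₀₁(τ) = ∑ₙ (−1)ⁿ exp(πi n² τ)`. -/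
def theta01 (τ : ℂ) : ℂ :=
  ∑' n : ℤ, (-1 : ℂ) ^ n * Complex.exp ((Real.pi : ℂ) * Complex.I * (n : ℂ) ^ 2 * τ)

/-- The genus-one thetanull `θ₁₀(τ) = ∑ₙ exp(πi (n+1/2)² τ)`. -/
def theta10 (τ : ℂ) : ℂ :=
  ∑' n : ℤ, Complex.exp ((Real.pi : ℂ) * Complex.I * ((n : ℂ) + 1 / 2) ^ 2 * τ)

/-- The logarithmic derivative `ψ_f = (1/πi) f′/f`. -/
def psiLog (f : ℂ → ℂ) (τ : ℂ) : ℂ :=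
  1 / ((Real.pi : ℂ) * Complex.I) * (deriv f τ / f τ)

section Helpers

open Filter Topology

/-! ### Identification with the Jacobi theta function -/

lemma theta00_eq (τ : ℂ) : theta00 τ = jacobiTheta₂ 0 τ := by
  unfold theta00 jacobiTheta₂ jacobiTheta₂_term
  refine tsum_congr fun n => ?_
  congr 1; ring

lemma neg_one_zpow_eq_exp (n : ℤ) : (-1 : ℂ) ^ n = cexp (2 * Real.pi * I * n * (1 / 2)) := by
  rw [← Complex.exp_pi_mul_I, ← Complex.exp_int_mul]
  congr 1; ring

lemma theta01_eq (τ : ℂ) : theta01 τ = jacobiTheta₂ (1 / 2) τ := by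
  unfold theta01 jacobiTheta₂ jacobiTheta₂_term
  refine tsum_congr fun n => ?_
  rw [neg_one_zpow_eq_exp, ← Complex.exp_add]

lemma theta10_eq (τ : ℂ) :
    theta10 τ = cexp (Real.pi * I * τ / 4) * jacobiTheta₂ (τ / 2) τ := by
  unfold theta10 jacobiTheta₂ jacobiTheta₂_term
  rw [← tsum_mul_left]
  refine tsum_congr fun n => ?_
  rw [← Complex.exp_add]
  congr 1; ring

lemma diff00 {τ : ℂ} (h : 0 < τ.im) : DifferentiableAt ℂ theta00 τ := by
  have : theta00 = fun τ => jacobiTheta₂ 0 τ := funext theta00_eq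
  rw [this]; exact differentiableAt_jacobiTheta₂_snd 0 h

lemma diff01 {τ : ℂ} (h : 0 < τ.im) : DifferentiableAt ℂ theta01 τ := by
  have : theta01 = fun τ => jacobiTheta₂ (1 / 2) τ := funext theta01_eq
  rw [this]; exact differentiableAt_jacobiTheta₂_snd _ h

def gAux (τ : ℂ) : ℂ := jacobiTheta₂ (τ / 2) τ

lemma diffg {τ : ℂ} (h : 0 < τ.im) : DifferentiableAt ℂ gAux τ := by
  have h1 : DifferentiableAt ℂ (fun p : ℂ × ℂ => jacobiTheta₂ p.1 p.2) (τ / 2, τ) :=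
    (hasFDerivAt_jacobiTheta₂ (τ / 2) h).differentiableAt
  have h2 : DifferentiableAt ℂ (fun t : ℂ => (t / 2, t)) τ := by fun_prop
  exact DifferentiableAt.comp (f := fun t : ℂ => (t / 2, t)) τ h1 h2

lemma theta10_fun : theta10 = fun τ => cexp (Real.pi * I * τ / 4) * gAux τ := funext theta10_eq

lemma diff10 {τ : ℂ} (h : 0 < τ.im) : DifferentiableAt ℂ theta10 τ := by
  rw [theta10_fun]
  exact DifferentiableAt.mul (by fun_prop) (diffg h)

/-! ### Periodicity -/

lemma per00 (τ : ℂ) : theta00 (τ + 2) = 1 * theta00 τ := by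
  rw [theta00_eq, theta00_eq, jacobiTheta₂_add_right, one_mul]

lemma per01 (τ : ℂ) : theta01 (τ + 2) = 1 * theta01 τ := by
  rw [theta01_eq, theta01_eq, jacobiTheta₂_add_right, one_mul]

lemma per10 (τ : ℂ) : theta10 (τ + 2) = cexp (Real.pi * I / 2) * theta10 τ := by
  rw [theta10_eq, theta10_eq, jacobiTheta₂_add_right, add_div, div_self two_ne_zero,
    jacobiTheta₂_add_left, ← mul_assoc, ← Complex.exp_add]
  congr 2; ring

lemma psi_per {f : ℂ → ℂ} {k : ℂ} (hk : k ≠ 0) (h : ∀ τ, f (τ + 2) = k * f τ) (τ : ℂ) :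
    psiLog f (τ + 2) = psiLog f τ := by
  have h1 : deriv f (τ + 2) = k * deriv f τ := by
    rw [← deriv_comp_add_const, funext h, deriv_const_mul_field]
  unfold psiLog
  rw [h1, h, mul_div_mul_left _ _ hk]

/-! ### Inversion -/

lemma inv_cpow_ne {τ : ℂ} (h : 0 < τ.im) : (-I * τ) ^ (1 / 2 : ℂ) ≠ 0 := by
  have : τ ≠ 0 := by rintro rfl; simp at h
  simp [Complex.cpow_eq_zero_iff, this]

lemma inv00 {τ : ℂ} (h : 0 < τ.im) :
    theta00 (-1 / τ) = (-I * τ) ^ (1 / 2 : ℂ) * theta00 τ := by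
  have h1 := inv_cpow_ne h
  rw [theta00_eq, theta00_eq, jacobiTheta₂_functional_equation 0 τ]
  have e2 : cexp (-Real.pi * I * 0 ^ 2 / τ) = 1 := by simp
  rw [e2, zero_div]
  generalize (-I * τ) ^ (1 / 2 : ℂ) = s at *
  field_simp

lemma inv01 {τ : ℂ} (h : 0 < τ.im) :
    theta01 (-1 / τ) = (-I * τ) ^ (1 / 2 : ℂ) * theta10 τ := by
  have h1 := inv_cpow_ne h
  have h0 : τ ≠ 0 := by rintro rfl; simp at h
  rw [theta01_eq, theta10_eq, jacobiTheta₂_functional_equation (τ / 2) τ]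
  have e1 : τ / 2 / τ = 1 / 2 := by field_simp
  have e2 : cexp (-Real.pi * I * (τ / 2) ^ 2 / τ) = (cexp (Real.pi * I * τ / 4))⁻¹ := by
    rw [← Complex.exp_neg]; congr 1; field_simp; ring
  have h3 := Complex.exp_ne_zero (Real.pi * I * τ / 4)
  rw [e1, e2]
  generalize (-I * τ) ^ (1 / 2 : ℂ) = s at *
  field_simp

lemma inv10 {τ : ℂ} (h : 0 < τ.im) :
    theta10 (-1 / τ) = (-I * τ) ^ (1 / 2 : ℂ) * theta01 τ := by
  have h1 := inv_cpow_ne h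
  have h0 : τ ≠ 0 := by rintro rfl; simp at h
  rw [theta10_eq, theta01_eq, jacobiTheta₂_functional_equation (1 / 2) τ]
  have e1 : jacobiTheta₂ (-1 / τ / 2) (-1 / τ) = jacobiTheta₂ (1 / 2 / τ) (-1 / τ) := by
    rw [← jacobiTheta₂_neg_left]; congr 1; field_simp
  have e2 : cexp (-Real.pi * I * (1 / 2) ^ 2 / τ) = cexp (Real.pi * I * (-1 / τ) / 4) := by
    congr 1; field_simp; norm_num
  rw [e1, e2]
  generalize (-I * τ) ^ (1 / 2 : ℂ) = s at *
  field_simp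

lemma im_inv_pos {τ : ℂ} (h : 0 < τ.im) : 0 < (-1 / τ).im := by
  have h0 : τ ≠ 0 := by rintro rfl; simp at h
  have : (-1 / τ).im = τ.im / Complex.normSq τ := by
    simp [neg_div, Complex.inv_im]
  rw [this]
  exact div_pos h (Complex.normSq_pos.2 h0)

lemma psi_inv {f g : ℂ → ℂ} (hf : ∀ τ : ℂ, 0 < τ.im → DifferentiableAt ℂ f τ)
    (hg : ∀ τ : ℂ, 0 < τ.im → DifferentiableAt ℂ g τ)
    (h : ∀ τ : ℂ, 0 < τ.im → f (-1 / τ) = (-I * τ) ^ (1 / 2 : ℂ) * g τ)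
    {τ : ℂ} (hτ : 0 < τ.im) (h0 : g τ ≠ 0) :
    psiLog f (-1 / τ) = τ ^ 2 * psiLog g τ + τ * (1 / (2 * Real.pi * I)) := by
  have ht : τ ≠ 0 := by rintro rfl; simp at hτ
  have hs := inv_cpow_ne hτ
  have hs' : HasDerivAt (fun t : ℂ => (-I * t) ^ (1 / 2 : ℂ))
      ((1 / 2 : ℂ) * (-I * τ) ^ ((1 / 2 : ℂ) - 1) * (-I * 1)) τ := by
    refine HasDerivAt.cpow_const ((hasDerivAt_id τ).const_mul (-I)) ?_
    left; simpa using hτ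
  have hpow : (-I * τ) ^ ((1 / 2 : ℂ) - 1) = (-I * τ) ^ (1 / 2 : ℂ) / (-I * τ) := by
    rw [Complex.cpow_sub _ _ (by simp [ht]), Complex.cpow_one]
  rw [hpow] at hs'
  have hr := hs'.mul (hg τ hτ).hasDerivAt
  have hi : HasDerivAt (fun t : ℂ => -1 / t) (1 / τ ^ 2) τ := by
    have := (hasDerivAt_inv ht).const_mul (-1)
    have e : (-1 : ℂ) * -(τ ^ 2)⁻¹ = 1 / τ ^ 2 := by ring
    rw [e] at this
    refine this.congr_of_eventuallyEq (Eventually.of_forall fun t => ?_)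
    exact div_eq_mul_inv _ _
  have hl := (hf _ (im_inv_pos hτ)).hasDerivAt.comp τ hi
  have heq : (f ∘ fun t : ℂ => -1 / t) =ᶠ[𝓝 τ] fun t => (-I * t) ^ (1 / 2 : ℂ) * g t := by
    have : ∀ᶠ t : ℂ in 𝓝 τ, 0 < t.im :=
      (isOpen_lt continuous_const Complex.continuous_im).mem_nhds hτ
    filter_upwards [this] with t ht using h t ht
  have key := hl.unique (hr.congr_of_eventuallyEq heq)
  unfold psiLog
  rw [h τ hτ]
  have hd : deriv f (-1 / τ) = τ ^ 2 * ((-I * τ) ^ (1 / 2 : ℂ) * (g τ / (2 * τ) + deriv g τ)) := by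
    have h2 : deriv f (-1 / τ) = τ ^ 2 * (deriv f (-1 / τ) * (1 / τ ^ 2)) := by field_simp
    rw [h2, key]
    generalize (-I * τ) ^ (1 / 2 : ℂ) = s at *
    field_simp
  rw [hd]
  generalize (-I * τ) ^ (1 / 2 : ℂ) = s at *
  have hpi : (Real.pi : ℂ) ≠ 0 := by exact_mod_cast Real.pi_ne_zero
  field_simp
  ring

/-! ### Limits at the cusp -/

/-- The filter `Im τ → ∞`. -/
def cusp : Filter ℂ := comap Complex.im atTop

lemma cusp_gt (T : ℝ) : ∀ᶠ τ in cusp, T < τ.im :=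
  (eventually_gt_atTop T).comap _

lemma cusp_ex {p : ℂ → Prop} (h : ∀ᶠ τ in cusp, p τ) : ∃ T : ℝ, 0 < T ∧ ∀ τ : ℂ, T < τ.im → p τ := by
  obtain ⟨s, hs, hs'⟩ := h
  obtain ⟨T, hT⟩ := mem_atTop_sets.1 hs
  exact ⟨max T 1, by positivity, fun τ h => hs' (hT _ ((le_max_left _ _).trans h.le))⟩

instance : cusp.NeBot := by
  refine comap_neBot fun t ht => ?_
  obtain ⟨T, hT⟩ := mem_atTop_sets.1 ht
  exact ⟨T * I, by simpa using hT T le_rfl⟩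

lemma series_tendsto (k : ℤ → ℤ) (ε : ℤ → ℂ) (hk : ∀ n, 0 ≤ k n) (hε : ∀ n, ‖ε n‖ ≤ 1)
    (hs : Summable fun n => Real.exp (-Real.pi * k n)) :
    Tendsto (fun τ : ℂ => ∑' n, ε n * cexp (Real.pi * I * k n * τ)) cusp
      (𝓝 (∑' n, if k n = 0 then ε n else 0)) := by
  have hnorm : ∀ n (τ : ℂ), ‖cexp (Real.pi * I * k n * τ)‖ = Real.exp (-Real.pi * k n * τ.im) := by
    intro n τ
    rw [Complex.norm_exp]; congr 1; simp
  refine tendsto_tsum_of_dominated_convergence hs (fun n => ?_) ?_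
  · split_ifs with h
    · simp [h]
    · have hpos : (0 : ℝ) < k n := by
        have := hk n
        exact_mod_cast lt_of_le_of_ne this (Ne.symm h)
      rw [← mul_zero (ε n)]
      refine Tendsto.const_mul _ ?_
      rw [tendsto_zero_iff_norm_tendsto_zero]
      simp_rw [hnorm]
      refine Real.tendsto_exp_atBot.comp ?_
      refine Tendsto.const_mul_atTop_of_neg ?_ tendsto_comap
      nlinarith [Real.pi_pos]
  · filter_upwards [cusp_gt 1] with τ hτ n
    rw [norm_mul, hnorm]
    refine (mul_le_of_le_one_left (Real.exp_pos _).le (hε n)).trans ?_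
    refine Real.exp_le_exp.2 ?_
    have : (0 : ℝ) ≤ k n := by exact_mod_cast hk n
    nlinarith [mul_nonneg Real.pi_pos.le this]

lemma summable_sq : Summable fun n : ℤ => Real.exp (-Real.pi * ((n ^ 2 : ℤ) : ℝ)) := by
  have := ((summable_jacobiTheta₂_term_iff 0 I).2 (by simp)).norm
  refine this.congr fun n => ?_
  rw [norm_jacobiTheta₂_term]
  congr 1; simp

lemma summable_sq_add : Summable fun n : ℤ => Real.exp (-Real.pi * ((n ^ 2 + n : ℤ) : ℝ)) := by
  have := ((summable_jacobiTheta₂_term_iff (I / 2) I).2 (by simp)).norm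
  refine this.congr fun n => ?_
  rw [norm_jacobiTheta₂_term]
  congr 1; simp; ring

lemma lim00 : Tendsto theta00 cusp (𝓝 1) := by
  have := series_tendsto (fun n => n ^ 2) (fun _ => 1) (fun n => sq_nonneg n) (by simp) summable_sq
  convert this using 2
  · unfold theta00; refine tsum_congr fun n => ?_
    push_cast; ring
  · simp

lemma lim01 : Tendsto theta01 cusp (𝓝 1) := by
  have := series_tendsto (fun n => n ^ 2) (fun n => (-1) ^ n) (fun n => sq_nonneg n) (by simp)
    summable_sq
  convert this using 2
  · unfold theta01; refine tsum_congr fun n => ?_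
    push_cast; ring
  · rw [tsum_eq_single 0] <;> simp +contextual

lemma limg : Tendsto gAux cusp (𝓝 2) := by
  have := series_tendsto (fun n => n ^ 2 + n) (fun _ => 1) (fun n => by
    rcases le_or_gt 0 n with h | h <;> nlinarith) (by simp) summable_sq_add
  convert this using 2
  · unfold gAux jacobiTheta₂ jacobiTheta₂_term; refine tsum_congr fun n => ?_
    rw [one_mul]; congr 1; push_cast; ring
  · rw [tsum_eq_sum (s := {0, -1})]
    · rw [Finset.sum_pair (by norm_num)]; norm_num
    · intro n hn
      simp only [Finset.mem_insert, Finset.mem_singleton, not_or] at hn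
      rw [if_neg]
      intro h
      have : n * (n + 1) = 0 := by linarith
      rcases mul_eq_zero.1 this with h | h
      · exact hn.1 h
      · exact hn.2 (by linarith)

lemma deriv_tendsto {f : ℂ → ℂ} {l : ℂ} (hf : ∀ τ : ℂ, 0 < τ.im → DifferentiableAt ℂ f τ)
    (h : Tendsto f cusp (𝓝 l)) : Tendsto (deriv f) cusp (𝓝 0) := by
  rw [Metric.tendsto_nhds]
  intro ε hε
  obtain ⟨T, hT, hT'⟩ := cusp_ex (Metric.tendsto_nhds.1 h (ε / 2) (by positivity))
  filter_upwards [cusp_gt (T + 1)] with τ hτ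
  have him : ∀ z ∈ Metric.closedBall τ 1, T < z.im := by
    intro z hz
    have h1 := (Complex.abs_im_le_norm (z - τ)).trans (mem_closedBall_iff_norm.1 hz)
    rw [Complex.sub_im] at h1
    have := (abs_le.1 h1).1
    linarith
  have hd : DiffContOnCl ℂ (fun z => f z - l) (Metric.ball τ 1) := by
    apply DifferentiableOn.diffContOnCl
    rw [closure_ball _ one_ne_zero]
    intro z hz
    exact ((hf z (hT.trans (him z hz))).sub_const l).differentiableWithinAt
  have := Complex.norm_deriv_le_of_forall_mem_sphere_norm_le one_pos hd (C := ε / 2) (fun z hz => by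
    have := hT' z (him z (Metric.sphere_subset_closedBall hz))
    rw [dist_eq_norm] at this
    exact this.le)
  rw [deriv_sub_const] at this
  rw [dist_zero_right]
  linarith

lemma psi_tendsto {f : ℂ → ℂ} {l : ℂ} (hl : l ≠ 0)
    (hf : ∀ τ : ℂ, 0 < τ.im → DifferentiableAt ℂ f τ)
    (h : Tendsto f cusp (𝓝 l)) : Tendsto (psiLog f) cusp (𝓝 0) := by
  have := ((deriv_tendsto hf h).div h hl).const_mul (1 / ((Real.pi : ℂ) * Complex.I))
  rw [zero_div, mul_zero] at this
  exact this

lemma psi10_eq {τ : ℂ} (h : 0 < τ.im) (h0 : gAux τ ≠ 0) :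
    psiLog theta10 τ = 1 / 4 + psiLog gAux τ := by
  have h1 : HasDerivAt (fun τ : ℂ => cexp (Real.pi * I * τ / 4))
      (cexp (Real.pi * I * τ / 4) * (Real.pi * I * 1 / 4)) τ :=
    (((hasDerivAt_id τ).const_mul (Real.pi * I : ℂ)).div_const 4).cexp
  have h2 := h1.mul (diffg h).hasDerivAt
  have h3 := Complex.exp_ne_zero (Real.pi * I * τ / 4)
  have hpi : (Real.pi : ℂ) ≠ 0 := by exact_mod_cast Real.pi_ne_zero
  have h4 : deriv theta10 τ = cexp (Real.pi * I * τ / 4) * (Real.pi * I * 1 / 4) * gAux τ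
      + cexp (Real.pi * I * τ / 4) * deriv gAux τ := by
    rw [theta10_fun]; exact h2.deriv
  unfold psiLog
  rw [h4, theta10_fun]
  field_simp

lemma psi10_tendsto : Tendsto (psiLog theta10) cusp (𝓝 (1 / 4)) := by
  have h := (psi_tendsto two_ne_zero (fun _ => diffg) limg).const_add (1 / 4 : ℂ)
  rw [add_zero] at h
  refine h.congr' ?_
  filter_upwards [cusp_gt 0, limg.eventually_ne two_ne_zero] with τ h1 h2
  exact (psi10_eq h1 h2).symm

/-- The invariant set on which all thetanulls are nonzero. -/
def good (τ : ℂ) : Prop := 0 < τ.im ∧ theta00 τ ≠ 0 ∧ theta01 τ ≠ 0 ∧ theta10 τ ≠ 0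

lemma good_ev : ∀ᶠ τ in cusp, good τ := by
  filter_upwards [cusp_gt 0, lim00.eventually_ne one_ne_zero, lim01.eventually_ne one_ne_zero,
    limg.eventually_ne two_ne_zero] with τ h1 h2 h3 h4
  refine ⟨h1, h2, h3, ?_⟩
  rw [theta10_fun]
  exact mul_ne_zero (Complex.exp_ne_zero _) h4

lemma good_add {τ : ℂ} (h : good τ) : good (τ + 2) := by
  obtain ⟨h1, h2, h3, h4⟩ := h
  refine ⟨by simpa using h1, ?_, ?_, ?_⟩
  · rw [per00]; simpa
  · rw [per01]; simpa
  · rw [per10]; exact mul_ne_zero (Complex.exp_ne_zero _) h4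

lemma good_inv {τ : ℂ} (h : good τ) : good (-1 / τ) := by
  obtain ⟨h1, h2, h3, h4⟩ := h
  have hs := inv_cpow_ne h1
  refine ⟨im_inv_pos h1, ?_, ?_, ?_⟩
  · rw [inv00 h1]; exact mul_ne_zero hs h2
  · rw [inv01 h1]; exact mul_ne_zero hs h4
  · rw [inv10 h1]; exact mul_ne_zero hs h3

lemma theta_ne {t : ℝ} (ht : 0 < t) : theta00 (t * I) ≠ theta01 (t * I) := by
  have him : 0 < ((t : ℂ) * I).im := by simpa using ht
  have s0 := hasSum_jacobiTheta₂_term 0 him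
  have s1 := hasSum_jacobiTheta₂_term (1 / 2) him
  have hs := s0.sub s1
  rw [← theta00_eq, ← theta01_eq] at hs
  intro h
  rw [h, sub_self] at hs
  have hre := Complex.hasSum_re hs
  have hterm : ∀ n : ℤ, (jacobiTheta₂_term n 0 (t * I) - jacobiTheta₂_term n (1 / 2) (t * I))
      = (((1 - (-1) ^ n) * Real.exp (-Real.pi * n ^ 2 * t) : ℝ) : ℂ) := by
    intro n
    unfold jacobiTheta₂_term
    rw [Complex.exp_add, Complex.exp_add, ← neg_one_zpow_eq_exp, ← sub_mul]
    have : (Real.pi : ℂ) * I * n ^ 2 * (t * I) = ((-Real.pi * n ^ 2 * t : ℝ) : ℂ) := by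
      push_cast
      linear_combination (Real.pi : ℂ) * n ^ 2 * t * I_mul_I
    rw [this]
    push_cast
    simp
  simp_rw [hterm, Complex.ofReal_re, Complex.zero_re] at hre
  have hnn : ∀ n : ℤ, 0 ≤ (1 - (-1 : ℝ) ^ n) * Real.exp (-Real.pi * n ^ 2 * t) := by
    intro n
    refine mul_nonneg ?_ (Real.exp_pos _).le
    rcases Int.even_or_odd n with h | h
    · simp [h.neg_one_zpow]
    · rw [h.neg_one_zpow]; norm_num
  have h1 := hre.summable.tsum_pos hnn 1 (by
    refine mul_pos (by norm_num) (Real.exp_pos _))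
  rw [hre.tsum_eq] at h1
  exact lt_irrefl _ h1

lemma freq_ne : ∃ᶠ τ in cusp, psiLog theta00 τ ≠ psiLog theta01 τ := by
  rw [Filter.Frequently]
  intro h
  simp only [not_not] at h
  obtain ⟨T, hT, hT'⟩ := cusp_ex (h.and good_ev)
  set s : Set ℂ := {τ | T < τ.im}
  have hs : IsOpen s := isOpen_lt continuous_const Complex.continuous_im
  have hc : Convex ℝ s := convex_halfSpace_im_gt T
  have hpi : (Real.pi : ℂ) ≠ 0 := by exact_mod_cast Real.pi_ne_zero
  have hD : ∀ τ ∈ s, HasDerivAt (fun τ => theta00 τ / theta01 τ) 0 τ := by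
    intro τ hτ
    obtain ⟨h1, h2, h3, h4, h5⟩ := hT' τ hτ
    have := (diff00 h2).hasDerivAt.div (diff01 h2).hasDerivAt h4
    unfold psiLog at h1
    have h6 : deriv theta00 τ / theta00 τ = deriv theta01 τ / theta01 τ :=
      mul_left_cancel₀ (by simp [hpi]) h1
    rw [div_eq_div_iff h3 h4] at h6
    have e : (deriv theta00 τ * theta01 τ - theta00 τ * deriv theta01 τ) / theta01 τ ^ 2 = 0 := by
      rw [h6]; ring
    rw [e] at this
    exact this
  have hconst : ∀ x ∈ s, ∀ y ∈ s, theta00 x / theta01 x = theta00 y / theta01 y := by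
    intro x hx y hy
    refine hs.is_const_of_deriv_eq_zero hc.isPreconnected
      (fun z hz => (hD z hz).differentiableAt.differentiableWithinAt)
      (fun z hz => (hD z hz).deriv) hx hy
  have hx : (((T + 1 : ℝ) : ℂ) * I) ∈ s := by simp [s]
  have hlim : Tendsto (fun τ => theta00 τ / theta01 τ) cusp (𝓝 1) := by
    have := lim00.div lim01 one_ne_zero
    rw [div_one] at this
    exact this
  have hlim2 : Tendsto (fun τ => theta00 τ / theta01 τ) cusp
      (𝓝 (theta00 (((T + 1 : ℝ) : ℂ) * I) / theta01 (((T + 1 : ℝ) : ℂ) * I))) := by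
    refine tendsto_const_nhds.congr' ?_
    filter_upwards [cusp_gt T] with τ hτ using hconst _ hx τ hτ
  have h7 := tendsto_nhds_unique hlim2 hlim
  obtain ⟨-, -, -, h4, -⟩ := hT' _ hx
  rw [div_eq_one_iff_eq h4] at h7
  exact theta_ne (by linarith) h7

/-! ### Polynomial arguments -/

/-- Evaluation of `P` at a triple. -/
def ev (P : MvPolynomial (Fin 3) ℚ) (x y z : ℂ) : ℂ := MvPolynomial.aeval ![x, y, z] P

lemma ev_poly (P : MvPolynomial (Fin 3) ℚ) (p q r : Polynomial ℂ) {S : Set ℂ} (hS : S.Infinite)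
    (h : ∀ z ∈ S, ev P (p.eval z) (q.eval z) (r.eval z) = 0) (z : ℂ) :
    ev P (p.eval z) (q.eval z) (r.eval z) = 0 := by
  have key : ∀ z, ev P (p.eval z) (q.eval z) (r.eval z)
      = (MvPolynomial.aeval ![p, q, r] P : Polynomial ℂ).eval z := by
    intro z
    unfold ev
    have h1 : (MvPolynomial.aeval ![p.eval z, q.eval z, r.eval z] : _ →ₐ[ℚ] ℂ)
        = ((Polynomial.aeval z).restrictScalars ℚ).comp (MvPolynomial.aeval ![p, q, r]) := by
      apply MvPolynomial.algHom_ext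
      intro i
      fin_cases i <;> simp
    rw [h1]; simp
  have h0 : (MvPolynomial.aeval ![p, q, r] P : Polynomial ℂ) = 0 := by
    apply Polynomial.eq_zero_of_infinite_isRoot
    refine hS.mono fun z hz => ?_
    have := h z hz
    rw [key] at this
    exact this
  rw [key, h0, Polynomial.eval_zero]


lemma good_add_nat {τ : ℂ} (h : good τ) (n : ℕ) : good (τ + 2 * n) := by
  induction n with
  | zero => simpa using h
  | succ k ih =>
    have := good_add ih
    have e : τ + 2 * (k + 1 : ℕ) = τ + 2 * k + 2 := by push_cast; ring
    rwa [e]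

lemma psi_per_nat {f : ℂ → ℂ} {k : ℂ} (hk : k ≠ 0) (h : ∀ τ, f (τ + 2) = k * f τ) (τ : ℂ) (n : ℕ) :
    psiLog f (τ + 2 * n) = psiLog f τ := by
  induction n with
  | zero => simp
  | succ m ih =>
    have e : τ + 2 * (m + 1 : ℕ) = τ + 2 * m + 2 := by push_cast; ring
    rw [e, psi_per hk h, ih]

lemma step (P : MvPolynomial (Fin 3) ℚ) (A u : ℂ)
    (h : ∀ τ, good τ → ev P (A * psiLog theta00 τ + u) (A * psiLog theta01 τ + u)
      (A * psiLog theta10 τ + u) = 0) (τ : ℂ) (hτ : good τ) (w : ℂ) :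
    ev P (A * (w ^ 2 * psiLog theta00 τ + w * (1 / (2 * Real.pi * I))) + u)
      (A * (w ^ 2 * psiLog theta10 τ + w * (1 / (2 * Real.pi * I))) + u)
      (A * (w ^ 2 * psiLog theta01 τ + w * (1 / (2 * Real.pi * I))) + u) = 0 := by
  set c : ℂ := 1 / (2 * Real.pi * I)
  let p : ℂ → Polynomial ℂ := fun a =>
    Polynomial.C A * (Polynomial.X ^ 2 * Polynomial.C a + Polynomial.X * Polynomial.C c)
      + Polynomial.C u
  have hp : ∀ a z, (p a).eval z = A * (z ^ 2 * a + z * c) + u := by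
    intro a z; simp only [p, Polynomial.eval_add, Polynomial.eval_mul, Polynomial.eval_pow, Polynomial.eval_C,
      Polynomial.eval_X]
  have hinf : (Set.range fun n : ℕ => τ + 2 * (n : ℂ)).Infinite := by
    refine Set.infinite_range_of_injective fun m n hmn => ?_
    simpa using hmn
  have := ev_poly P (p (psiLog theta00 τ)) (p (psiLog theta10 τ)) (p (psiLog theta01 τ)) hinf ?_ w
  · simpa only [hp] using this
  · rintro _ ⟨n, rfl⟩
    simp only [hp]
    have hg := good_add_nat hτ n
    have h1 := h _ (good_inv hg)
    rw [psi_inv (fun _ => diff00) (fun _ => diff00) (fun _ => inv00) hg.1 hg.2.1,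
      psi_inv (fun _ => diff01) (fun _ => diff10) (fun _ => inv01) hg.1 hg.2.2.2,
      psi_inv (fun _ => diff10) (fun _ => diff01) (fun _ => inv10) hg.1 hg.2.2.1,
      psi_per_nat one_ne_zero per00, psi_per_nat one_ne_zero per01,
      psi_per_nat (Complex.exp_ne_zero _) per10] at h1
    exact h1

lemma ev_swap (P : MvPolynomial (Fin 3) ℚ) (x y z : ℂ) :
    ev (MvPolynomial.rename (Equiv.swap (1 : Fin 3) 2) P) x y z = ev P x z y := by
  unfold ev
  rw [MvPolynomial.aeval_rename]
  congr 2
  funext i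
  fin_cases i <;> simp [Equiv.swap_apply_def]

lemma plane (P : MvPolynomial (Fin 3) ℚ)
    (h : ∀ τ, good τ → ev P (psiLog theta00 τ) (psiLog theta01 τ) (psiLog theta10 τ) = 0)
    (τ : ℂ) (hτ : good τ) (t y : ℂ) :
    ev P (t * psiLog theta00 τ + y) (t * psiLog theta01 τ + y) (t * psiLog theta10 τ + y) = 0 := by
  have hpi : (Real.pi : ℂ) ≠ 0 := by exact_mod_cast Real.pi_ne_zero
  set c : ℂ := 1 / (2 * Real.pi * I) with hc
  have hc0 : c ≠ 0 := by simp [hc, hpi]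
  have s1 := step P 1 0 (by simpa using h)
  have s2 : ∀ z τ, good τ → ∀ w, _ := fun z => step (MvPolynomial.rename (Equiv.swap (1 : Fin 3) 2) P)
    (z ^ 2) (z * c) (fun τ hτ => by
      rw [ev_swap]
      simpa only [one_mul, add_zero, ← hc] using s1 τ hτ z)
  simp only [ev_swap, ← hc] at s2
  -- generic points
  obtain ⟨x, hx, hx1⟩ : ∃ x : ℂ, x ^ 2 = t ∧ x + 1 ≠ 0 := by
    obtain ⟨x, hx⟩ := IsAlgClosed.exists_pow_nat_eq t (n := 2) two_pos
    by_cases h1 : x + 1 = 0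
    · refine ⟨-x, by simpa using hx, fun h2 => ?_⟩
      have : (2 : ℂ) = 0 := by linear_combination h1 + h2
      exact two_ne_zero this
    · exact ⟨x, hx, h1⟩
  have gen : ∀ y ∈ ({0}ᶜ : Set ℂ), ev P (t * psiLog theta00 τ + y) (t * psiLog theta01 τ + y)
      (t * psiLog theta10 τ + y) = 0 := by
    intro y hy
    have hy0 : y ≠ 0 := hy
    have hz : y / c / (x + 1) ≠ 0 := div_ne_zero (div_ne_zero hy0 hc0) hx1
    have := s2 (y / c / (x + 1)) τ hτ (x / (y / c / (x + 1)))
    have e : ∀ a : ℂ, (y / c / (x + 1)) ^ 2 * ((x / (y / c / (x + 1))) ^ 2 * a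
        + (x / (y / c / (x + 1))) * c) + (y / c / (x + 1)) * c = t * a + y := by
      intro a
      rw [← hx]
      clear_value c
      field_simp
      ring
    simpa only [e] using this
  have := ev_poly P (Polynomial.C (t * psiLog theta00 τ) + Polynomial.X)
    (Polynomial.C (t * psiLog theta01 τ) + Polynomial.X)
    (Polynomial.C (t * psiLog theta10 τ) + Polynomial.X)
    (Set.finite_singleton (0 : ℂ)).infinite_compl (by simpa using gen) y
  simpa using this

/-- The slope invariant of the plane spanned by the `ψ` vector and `(1,1,1)`. -/
def slope3 (τ : ℂ) : ℂ :=
  (psiLog theta01 τ - psiLog theta10 τ) / (psiLog theta00 τ - psiLog theta10 τ)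

lemma slope_infinite :
    (slope3 '' {τ | good τ ∧ psiLog theta00 τ - psiLog theta10 τ ≠ 0}).Infinite := by
  have l0 := psi_tendsto one_ne_zero (fun _ => diff00) lim00
  have l1 := psi_tendsto one_ne_zero (fun _ => diff01) lim01
  have hne : (0 - 1 / 4 : ℂ) ≠ 0 := by norm_num
  have d0 := l0.sub psi10_tendsto
  have d1 := l1.sub psi10_tendsto
  have hlim : Tendsto slope3 cusp (𝓝 1) := by
    have := d1.div d0 hne
    rwa [div_self hne] at this
  have hev := good_ev.and (d0.eventually_ne hne)
  intro hfin
  have hopen : ∀ᶠ z in 𝓝 (1 : ℂ),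
      z ∉ (slope3 '' {τ | good τ ∧ psiLog theta00 τ - psiLog theta10 τ ≠ 0}) \ {1} :=
    (hfin.subset Set.sdiff_subset).isClosed.isOpen_compl.mem_nhds (by simp)
  obtain ⟨τ, h1, h2, h3⟩ := (freq_ne.and_eventually (hev.and (hlim.eventually hopen))).exists
  apply h3
  refine ⟨⟨τ, h2, rfl⟩, fun h4 => h1 ?_⟩
  have h5 : slope3 τ = 1 := h4
  unfold slope3 at h5
  rw [div_eq_one_iff_eq h2.2] at h5
  exact (sub_left_injective h5).symm

lemma ev_all (P : MvPolynomial (Fin 3) ℚ)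
    (h : ∀ τ, good τ → ev P (psiLog theta00 τ) (psiLog theta01 τ) (psiLog theta10 τ) = 0)
    (p q r : ℂ) : ev P p q r = 0 := by
  have A : ∀ p ∈ ({r}ᶜ : Set ℂ), ev P p q r = 0 := by
    intro p hp
    have hpr : p - r ≠ 0 := sub_ne_zero.2 hp
    have hinf := slope_infinite
    have := ev_poly P (Polynomial.C p) (Polynomial.C r + Polynomial.X * Polynomial.C (p - r))
      (Polynomial.C r) hinf ?_ ((q - r) / (p - r))
    · simpa [div_mul_cancel₀ _ hpr] using this
    · rintro _ ⟨τ, ⟨hg, hd⟩, rfl⟩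
      have h1 := plane P h τ hg ((p - r) / (psiLog theta00 τ - psiLog theta10 τ))
        (r - (p - r) / (psiLog theta00 τ - psiLog theta10 τ) * psiLog theta10 τ)
      simp only [Polynomial.eval_add, Polynomial.eval_mul, Polynomial.eval_C, Polynomial.eval_X]
      convert h1 using 2
      · field_simp; ring
      · unfold slope3; field_simp; ring
      · ring
  have := ev_poly P Polynomial.X (Polynomial.C q) (Polynomial.C r)
    (Set.finite_singleton r).infinite_compl (by simpa using A) p
  simpa using this

end Helpers

/-- `ψ₀₀, ψ₀₁, ψ₁₀` are algebraically independent over `ℚ`. -/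
theorem psi_algebraically_independent (P : MvPolynomial (Fin 3) ℚ) (hP : P ≠ 0) :
    ∃ τ : ℂ, 0 < τ.im ∧
      MvPolynomial.aeval ![psiLog theta00 τ, psiLog theta01 τ, psiLog theta10 τ] P ≠ 0 := by
  by_contra hcon
  push Not at hcon
  apply hP
  have hall : ∀ x : Fin 3 → ℂ, MvPolynomial.eval x (MvPolynomial.map (algebraMap ℚ ℂ) P) = 0 := by
    intro x
    have h1 := ev_all P (fun τ hτ => hcon τ hτ.1) (x 0) (x 1) (x 2)
    have h2 : ![x 0, x 1, x 2] = x := by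
      funext i; fin_cases i <;> rfl
    unfold ev at h1
    rw [h2] at h1
    rwa [MvPolynomial.eval_map, ← MvPolynomial.aeval_def]
  apply MvPolynomial.map_injective (algebraMap ℚ ℂ) (algebraMap ℚ ℂ).injective
  rw [map_zero]
  exact MvPolynomial.funext fun x => by rw [hall x, map_zero]
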